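/- Let P be an m-colored poset. Then the set of all m-colored P-partitions is the disjoint union, over all linear extensions π of P, of the sets of m-colored π-partitions: A^(m)(P; S_m) = ⨆_{π ∈ L(P)} A^(m)(π; S_m). -/

import Mathlib

/-- An `m`-colored poset: a finite set of `m`-colored positive integers
(`ℙ_m = Lex (ℕ+ × Fin m)`, ordered `1 < ω1 < ⋯ < ω^{m−1}1 < 2 < ω2 < ⋯`)
with pairwise distinct absolute values, with a strict partial order. -/
structure ColoredPoset (m : ℕ) where
  carrier : Finset (Lex (ℕ+ × Fin m))
  lt : Lex (ℕ+ × Fin m) → Lex (ℕ+ × Fin m) → Prop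
  mem_of_lt : ∀ {a b}, lt a b → a ∈ carrier ∧ b ∈ carrier
  lt_irrefl : ∀ a, ¬ lt a a
  lt_trans : ∀ {a b c}, lt a b → lt b c → lt a c
  distinct_abs : ∀ a ∈ carrier, ∀ b ∈ carrier, (ofLex a).1 = (ofLex b).1 → a = b

/-- The strict total order determined by a list: `a` occurs (strictly) before `b`. -/
def chainRel {α : Type*} (l : List α) (a b : α) : Prop :=
  ∃ i j : Fin l.length, i < j ∧ l.get i = a ∧ l.get j = b

/-- `π` is a linear extension of the poset whose elements are given by `mem`
and whose order is `r`. -/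
def IsLinearExtension {α : Type*} (mem : α → Prop) (r : α → α → Prop) (π : List α) : Prop :=
  π.Nodup ∧ (∀ x, x ∈ π ↔ mem x) ∧ ∀ a b, r a b → chainRel π a b

/-- `f` is an `m`-colored `P`-partition for the strict order `r` on the carrier
`c ⊆ ℙ_m`, with values in a totally ordered set `A` whose elements have colors
given by `κ` (e.g. `A = S_m = Lex (S × Fin m)`): `f` preserves colors,
`f i ≤ f j` whenever `i <_P j`, and `f i < f j` whenever moreover `i > j` in `ℙ_m`. -/
def IsColoredPPartition {m : ℕ} {A : Type*} [Preorder A] (κ : A → Fin m)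
    {c : Finset (Lex (ℕ+ × Fin m))} (r : Lex (ℕ+ × Fin m) → Lex (ℕ+ × Fin m) → Prop)
    (f : {x // x ∈ c} → A) : Prop :=
  (∀ i : {x // x ∈ c}, κ (f i) = (ofLex i.1).2) ∧
  ∀ a b : {x // x ∈ c}, r a.1 b.1 → f a ≤ f b ∧ (b.1 < a.1 → f a < f b)

/-- The strict total order on the carrier induced by `f`. -/
def fRel {m : ℕ} {A : Type*} [LinearOrder A] {c : Finset (Lex (ℕ+ × Fin m))}
    (f : {x // x ∈ c} → A) (x y : Lex (ℕ+ × Fin m)) : Prop :=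
  ∃ (hx : x ∈ c) (hy : y ∈ c), f ⟨x, hx⟩ < f ⟨y, hy⟩ ∨ (f ⟨x, hx⟩ = f ⟨y, hy⟩ ∧ x < y)

theorem fRel_asymm {m : ℕ} {A : Type*} [LinearOrder A] {c : Finset (Lex (ℕ+ × Fin m))}
    (f : {x // x ∈ c} → A) {x y : Lex (ℕ+ × Fin m)} (h : fRel f x y) (h' : fRel f y x) :
    False := by
  obtain ⟨hx, hy, h⟩ := h
  obtain ⟨_, _, h'⟩ := h'
  rcases h with h | ⟨h, h2⟩ <;> rcases h' with h' | ⟨h', h3⟩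
  · exact lt_asymm h h'
  · exact h.ne' h'
  · exact h'.ne' h
  · exact lt_asymm h2 h3

theorem chainRel_of_pairwise {α : Type*} {R : α → α → Prop} {l : List α} :
    l.Pairwise R ↔ ∀ a b, chainRel l a b → R a b := by
  rw [List.pairwise_iff_get]
  constructor
  · rintro h a b ⟨i, j, hij, rfl, rfl⟩
    exact h i j hij
  · intro h i j hij
    exact h _ _ ⟨i, j, hij, rfl, rfl⟩

theorem part_iff {m : ℕ} {A : Type*} [LinearOrder A] {c : Finset (Lex (ℕ+ × Fin m))}
    (κ : A → Fin m) (r : Lex (ℕ+ × Fin m) → Lex (ℕ+ × Fin m) → Prop)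
    (hr : ∀ a, ¬ r a a) (hm : ∀ a b, r a b → a ∈ c ∧ b ∈ c) (f : {x // x ∈ c} → A) :
    IsColoredPPartition κ r f ↔
      (∀ i : {x // x ∈ c}, κ (f i) = (ofLex i.1).2) ∧ ∀ a b, r a b → fRel f a b := by
  refine and_congr_right fun _ => ?_
  constructor
  · intro h a b hab
    obtain ⟨ha, hb⟩ := hm a b hab
    refine ⟨ha, hb, ?_⟩
    obtain ⟨h1, h2⟩ := h ⟨a, ha⟩ ⟨b, hb⟩ hab
    rcases h1.lt_or_eq with h3 | h3
    · exact Or.inl h3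
    · rcases lt_trichotomy a b with h4 | h4 | h4
      · exact Or.inr ⟨h3, h4⟩
      · subst h4
        exact absurd hab (hr a)
      · exact Or.inl (h2 h4)
  · rintro h ⟨a, ha⟩ ⟨b, hb⟩ hab
    obtain ⟨_, _, h3 | ⟨h3, h4⟩⟩ := h a b hab
    · exact ⟨h3.le, fun _ => h3⟩
    · exact ⟨h3.le, fun h5 => absurd h5 (lt_asymm h4)⟩

theorem chain_part_iff {m : ℕ} {A : Type*} [LinearOrder A] {c : Finset (Lex (ℕ+ × Fin m))}
    (κ : A → Fin m) (l : List (Lex (ℕ+ × Fin m))) (hl : l.Nodup) (hm : ∀ x, x ∈ l ↔ x ∈ c)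
    (f : {x // x ∈ c} → A) :
    IsColoredPPartition κ (chainRel l) f ↔
      (∀ i : {x // x ∈ c}, κ (f i) = (ofLex i.1).2) ∧ l.Pairwise (fRel f) := by
  rw [chainRel_of_pairwise]
  apply part_iff
  · rintro a ⟨i, j, hij, h1, h2⟩
    exact hij.ne (List.nodup_iff_injective_get.1 hl (h1.trans h2.symm))
  · rintro a b ⟨i, j, hij, rfl, rfl⟩
    exact ⟨(hm _).1 (List.get_mem _ _), (hm _).1 (List.get_mem _ _)⟩

theorem exists_sorted {m : ℕ} {A : Type*} [LinearOrder A] {c : Finset (Lex (ℕ+ × Fin m))}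
    (f : {x // x ∈ c} → A) :
    ∃ l : List (Lex (ℕ+ × Fin m)), l.Nodup ∧ (∀ x, x ∈ l ↔ x ∈ c) ∧ l.Pairwise (fRel f) := by
  classical
  let s : Finset (Lex (A × Lex (ℕ+ × Fin m))) := c.attach.image fun i => toLex (f i, i.1)
  have hs : ∀ z ∈ s, ∃ h : (ofLex z).2 ∈ c, f ⟨_, h⟩ = (ofLex z).1 := by
    intro z hz
    obtain ⟨i, _, rfl⟩ := Finset.mem_image.1 hz
    exact ⟨i.2, rfl⟩
  let l := (s.sort (· ≤ ·)).map fun z => (ofLex z).2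
  have hp : l.Pairwise (fRel f) := by
    rw [List.pairwise_map]
    refine List.Pairwise.imp_of_mem ?_ (Finset.sortedLT_sort s).pairwise
    intro a b ha hb hab
    obtain ⟨ha1, ha2⟩ := hs a ((Finset.mem_sort _).1 ha)
    obtain ⟨hb1, hb2⟩ := hs b ((Finset.mem_sort _).1 hb)
    refine ⟨ha1, hb1, ?_⟩
    rw [ha2, hb2]
    exact (Prod.lex_def).1 hab
  refine ⟨l, ?_, ?_, hp⟩
  · refine List.Pairwise.imp ?_ hp
    rintro a b h rfl
    exact fRel_asymm f h h
  · intro x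
    rw [List.mem_map]
    constructor
    · rintro ⟨z, hz, rfl⟩
      exact (hs z ((Finset.mem_sort _).1 hz)).1
    · intro hx
      exact ⟨toLex (f ⟨x, hx⟩, x), (Finset.mem_sort _).2
        (Finset.mem_image.2 ⟨⟨x, hx⟩, Finset.mem_attach _ _, rfl⟩), rfl⟩

/-- The set of all `m`-colored `P`-partitions `A^(m)(P;S_m)` is the disjoint
union over all linear extensions `π ∈ L(P)` of the sets of `m`-colored
`π`-partitions. -/
theorem statement13 {m : ℕ} (P : ColoredPoset m) (S : Type*) [LinearOrder S] [Countable S] :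
    ({f : {x // x ∈ P.carrier} → Lex (S × Fin m) |
        IsColoredPPartition (fun z => (ofLex z).2) P.lt f} =
      ⋃ π ∈ {π : List (Lex (ℕ+ × Fin m)) | IsLinearExtension (· ∈ P.carrier) P.lt π},
        {f : {x // x ∈ P.carrier} → Lex (S × Fin m) |
          IsColoredPPartition (fun z => (ofLex z).2) (chainRel π) f}) ∧
    ∀ π ∈ {π : List (Lex (ℕ+ × Fin m)) | IsLinearExtension (· ∈ P.carrier) P.lt π},
      ∀ π' ∈ {π : List (Lex (ℕ+ × Fin m)) | IsLinearExtension (· ∈ P.carrier) P.lt π},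
        π ≠ π' →
        Disjoint
          {f : {x // x ∈ P.carrier} → Lex (S × Fin m) |
            IsColoredPPartition (fun z => (ofLex z).2) (chainRel π) f}
          {f : {x // x ∈ P.carrier} → Lex (S × Fin m) |
            IsColoredPPartition (fun z => (ofLex z).2) (chainRel π') f} := by
  classical
  constructor
  · ext f
    simp only [Set.mem_setOf_eq, Set.mem_iUnion, exists_prop]
    rw [part_iff _ _ P.lt_irrefl (fun a b h => P.mem_of_lt h)]
    constructor
    · rintro ⟨hc, hf⟩
      obtain ⟨l, h1, h2, h3⟩ := exists_sorted f
      refine ⟨l, ⟨h1, h2, ?_⟩, (chain_part_iff _ l h1 h2 f).2 ⟨hc, h3⟩⟩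
      intro a b hab
      obtain ⟨ha, hb⟩ := P.mem_of_lt hab
      obtain ⟨i, hi⟩ := List.get_of_mem ((h2 a).2 ha)
      obtain ⟨j, hj⟩ := List.get_of_mem ((h2 b).2 hb)
      rcases lt_trichotomy i j with h | h | h
      · exact ⟨i, j, h, hi, hj⟩
      · subst h
        rw [hi] at hj
        subst hj
        exact absurd hab (P.lt_irrefl _)
      · exact (fRel_asymm f (hf a b hab)
          (chainRel_of_pairwise.1 h3 b a ⟨j, i, h, hj, hi⟩)).elim
    · rintro ⟨l, ⟨h1, h2, h3⟩, h4⟩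
      obtain ⟨hc, h5⟩ := (chain_part_iff _ l h1 h2 f).1 h4
      exact ⟨hc, fun a b hab => chainRel_of_pairwise.1 h5 a b (h3 a b hab)⟩
  · rintro π ⟨h1, h2, _⟩ π' ⟨h1', h2', _⟩ hne
    rw [Set.disjoint_left]
    intro f hf hf'
    obtain ⟨_, h⟩ := (chain_part_iff _ π h1 h2 f).1 hf
    obtain ⟨_, h'⟩ := (chain_part_iff _ π' h1' h2' f).1 hf'
    apply hne
    have hp : π.Perm π' := (List.perm_ext_iff_of_nodup h1 h1').2 fun x =>
      (h2 x).trans (h2' x).symm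
    exact List.Perm.eq_of_pairwise (fun a b _ _ h h' => (fRel_asymm f h h').elim) h h' hp
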